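/- Let (C•,d_C), (D•,d_D) be cochain complexes in 𝒞, f : C• → D•, g : D• → C• cochain maps, H : g∘f → 1_{C•} and K : f∘g → 1_{D•} homotopies. Fix graded lifts C̄•, D̄• along F and graded lifts d̄_C, d̄_D, f̄, ḡ, H̄, K̄ of d_C, d_D, f, g, H, K respectively; write δ̄ for δ_{d̄_C,d̄_C}, δ_{d̄_C,d̄_D}, δ_{d̄_D,d̄_C}, δ_{d̄_D,d̄_D} as appropriate. Let ξ be a graded map in 𝒞̄ of degree m with F(ξ) = 0 and δ̄(ξ) = 0 (with source and target among C̄•, D̄• so that the compositions below make sense). Then: (1) each of (1 − ḡ∘f̄)∘ξ, ξ∘(1 − ḡ∘f̄), (1 − f̄∘ḡ)∘ξ and ξ∘(1 − f̄∘ḡ) equals δ̄(ε) for some graded map ε with F(ε) = 0; and (2) if one of f̄∘ξ, ξ∘f̄, ḡ∘ξ, ξ∘ḡ equals δ̄(ε) for some ε with F(ε) = 0, then ξ = δ̄(η) for some η with F(η) = 0. -/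

import Mathlib

open CategoryTheory

namespace Paper

/-- A graded object: a `ℤ`-indexed family of objects. -/
abbrev GradedObj (A : Type*) [Category A] := ℤ → A

/-- A graded map of degree `n` from `X` to `Y`. -/
abbrev GMap {A : Type*} [Category A] (X Y : GradedObj A) (n : ℤ) :=
  ∀ i : ℤ, X i ⟶ Y (i + n)

/-- Composition of graded maps, in diagrammatic order (`gcomp h f g` is "`g ∘ f`"),
with prescribed total degree `k = n + m`. -/
def gcomp {A : Type*} [Category A] {X Y Z : GradedObj A} {n m k : ℤ} (h : n + m = k)
    (f : GMap X Y n) (g : GMap Y Z m) : GMap X Z k :=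
  fun i => f i ≫ g (i + n) ≫ eqToHom (congrArg Z (show i + n + m = i + k by omega))

/-- The identity graded map of degree `0`. -/
def gid {A : Type*} [Category A] (X : GradedObj A) : GMap X X 0 :=
  fun i => eqToHom (congrArg X (add_zero i).symm)

/-- `δ(f) = d_Y ∘ f - (-1)ⁿ ⬝ f ∘ d_X` for pre-differentials `d_X`, `d_Y` and a graded
map `f` of degree `n`; the result has degree `m = n + 1`. -/
def gdelta {A : Type*} [Category A] [Preadditive A] {X Y : GradedObj A}
    (dX : GMap X X 1) (dY : GMap Y Y 1) {n m : ℤ} (h : n + 1 = m) (f : GMap X Y n) :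
    GMap X Y m :=
  gcomp h f dY - (n.negOnePow : ℤ) • gcomp (show 1 + n = m by omega) dX f

/-- The image of a graded object under a functor. -/
abbrev Fgr {A B : Type*} [Category A] [Category B] (F : B ⥤ A) (X : GradedObj B) :
    GradedObj A := fun i => F.obj (X i)

/-- The image of a graded map under a functor. -/
def Fmap {A B : Type*} [Category A] [Category B] (F : B ⥤ A) {X Y : GradedObj B} {n : ℤ}
    (f : GMap X Y n) : GMap (Fgr F X) (Fgr F Y) n := fun i => F.map (f i)

/-- `Ker(F)² = 0`: the composite of two `F`-killed morphisms vanishes. -/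
def KerSq {A B : Type*} [Category A] [Category B] [Preadditive A] [Preadditive B]
    (F : B ⥤ A) : Prop :=
  ∀ ⦃X Y Z : B⦄ (u : X ⟶ Y) (v : Y ⟶ Z), F.map u = 0 → F.map v = 0 → u ≫ v = 0

/-- `f : (X,dX) → (Y,dY)` and `g : (Y,dY) → (X,dX)` are cochain maps which are homotopy
inverse to each other. -/
def IsHomotopyEquivPair {A : Type*} [Category A] [Preadditive A] {X Y : GradedObj A}
    (dX : GMap X X 1) (dY : GMap Y Y 1) (f : GMap X Y 0) (g : GMap Y X 0) : Prop :=
  gdelta dX dY (show (0:ℤ) + 1 = 1 by omega) f = 0 ∧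
  gdelta dY dX (show (0:ℤ) + 1 = 1 by omega) g = 0 ∧
  (∃ H : GMap X X (-1), gdelta dX dX (show (-1:ℤ) + 1 = 0 by omega) H
      = gid X - gcomp (show (0:ℤ) + 0 = 0 by omega) f g) ∧
  (∃ K : GMap Y Y (-1), gdelta dY dY (show (-1:ℤ) + 1 = 0 by omega) K
      = gid Y - gcomp (show (0:ℤ) + 0 = 0 by omega) g f)


section GradedMaps

variable {A : Type*} [Category A]

theorem gcomp_apply {X Y Z : GradedObj A} {n m k : ℤ} (h : n + m = k)
    (f : GMap X Y n) (g : GMap Y Z m) (i j : ℤ) (hj : i + n = j) :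
    gcomp h f g i = f i ≫ eqToHom (congrArg Y hj) ≫ g j ≫
      eqToHom (congrArg Z (show j + m = i + k by omega)) := by
  subst hj
  simp [gcomp]

theorem gcomp_assoc {X Y Z W : GradedObj A} {n m p a b k : ℤ}
    (hnm : n + m = a) (hap : a + p = k) (hmp : m + p = b) (hnb : n + b = k)
    (f : GMap X Y n) (g : GMap Y Z m) (u : GMap Z W p) :
    gcomp hap (gcomp hnm f g) u = gcomp hnb f (gcomp hmp g u) := by
  funext i
  rw [gcomp_apply hap _ u i (i + n + m) (by omega), gcomp_apply hnb f _ i (i + n) rfl]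
  simp [gcomp]

theorem gcomp_gid {X Y : GradedObj A} {n : ℤ} (h : n + 0 = n) (f : GMap X Y n) :
    gcomp h f (gid Y) = f := by
  funext i
  simp [gcomp, gid]

theorem gid_gcomp {X Y : GradedObj A} {n : ℤ} (h : 0 + n = n) (f : GMap X Y n) :
    gcomp h (gid X) f = f := by
  funext i
  rw [gcomp_apply h _ f i i (add_zero i)]
  simp [gid]

variable [Preadditive A]

theorem gcomp_add {X Y Z : GradedObj A} {n m k : ℤ} (h : n + m = k)
    (f : GMap X Y n) (g g' : GMap Y Z m) :
    gcomp h f (g + g') = gcomp h f g + gcomp h f g' := by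
  funext i
  simp [gcomp]

theorem add_gcomp {X Y Z : GradedObj A} {n m k : ℤ} (h : n + m = k)
    (f f' : GMap X Y n) (g : GMap Y Z m) :
    gcomp h (f + f') g = gcomp h f g + gcomp h f' g := by
  funext i
  simp [gcomp]

theorem gcomp_sub {X Y Z : GradedObj A} {n m k : ℤ} (h : n + m = k)
    (f : GMap X Y n) (g g' : GMap Y Z m) :
    gcomp h f (g - g') = gcomp h f g - gcomp h f g' := by
  funext i
  simp [gcomp]

theorem sub_gcomp {X Y Z : GradedObj A} {n m k : ℤ} (h : n + m = k)
    (f f' : GMap X Y n) (g : GMap Y Z m) :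
    gcomp h (f - f') g = gcomp h f g - gcomp h f' g := by
  funext i
  simp [gcomp]

theorem gcomp_zsmul {X Y Z : GradedObj A} {n m k : ℤ} (h : n + m = k) (c : ℤ)
    (f : GMap X Y n) (g : GMap Y Z m) :
    gcomp h f (c • g) = c • gcomp h f g := by
  funext i
  simp [gcomp]

theorem zsmul_gcomp {X Y Z : GradedObj A} {n m k : ℤ} (h : n + m = k) (c : ℤ)
    (f : GMap X Y n) (g : GMap Y Z m) :
    gcomp h (c • f) g = c • gcomp h f g := by
  funext i
  simp [gcomp]

theorem gcomp_zero {X Y Z : GradedObj A} {n m k : ℤ} (h : n + m = k) (f : GMap X Y n) :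
    gcomp h f (0 : GMap Y Z m) = 0 := by
  funext i
  simp [gcomp]

theorem zero_gcomp {X Y Z : GradedObj A} {n m k : ℤ} (h : n + m = k) (g : GMap Y Z m) :
    gcomp h (0 : GMap X Y n) g = 0 := by
  funext i
  simp [gcomp]

theorem gdelta_add {X Y : GradedObj A} (dX : GMap X X 1) (dY : GMap Y Y 1) {n m : ℤ}
    (h : n + 1 = m) (f g : GMap X Y n) :
    gdelta dX dY h (f + g) = gdelta dX dY h f + gdelta dX dY h g := by
  simp only [gdelta, gcomp_add, add_gcomp, smul_add]
  abel

theorem gdelta_zsmul {X Y : GradedObj A} (dX : GMap X X 1) (dY : GMap Y Y 1) {n m : ℤ}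
    (h : n + 1 = m) (c : ℤ) (f : GMap X Y n) :
    gdelta dX dY h (c • f) = c • gdelta dX dY h f := by
  simp only [gdelta, gcomp_zsmul, zsmul_gcomp, smul_sub, smul_comm c]

/-- The graded Leibniz rule `δ(g ∘ f) = δ(g) ∘ f + (-1)^|g| g ∘ δ(f)`, which holds for
arbitrary pre-differentials. -/
theorem gdelta_gcomp {X Y Z : GradedObj A} (dX : GMap X X 1) (dY : GMap Y Y 1)
    (dZ : GMap Z Z 1) {n m k n' m' k' : ℤ} (h : n + m = k) (hn : n + 1 = n')
    (hm : m + 1 = m') (hk : k + 1 = k') (f : GMap X Y n) (g : GMap Y Z m) :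
    gdelta dX dZ hk (gcomp h f g) =
      gcomp (show n + m' = k' by omega) f (gdelta dY dZ hm g) +
        (m.negOnePow : ℤ) • gcomp (show n' + m = k' by omega) (gdelta dX dY hn f) g := by
  have hc : (k.negOnePow : ℤ) = (m.negOnePow : ℤ) * (n.negOnePow : ℤ) := by
    rw [← h, Int.negOnePow_add, mul_comm, Units.val_mul]
  simp only [gdelta, gcomp_sub, sub_gcomp, gcomp_zsmul, zsmul_gcomp, smul_sub, smul_smul]
  rw [gcomp_assoc h hk hm (by omega), gcomp_assoc hn (by omega) (show 1 + m = m' by omega)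
    (by omega), gcomp_assoc (show 1 + n = n' by omega) (by omega) h (by omega), hc]
  abel

end GradedMaps

section Functor

variable {A B : Type*} [Category A] [Category B] (F : B ⥤ A)

theorem Fmap_gid (X : GradedObj B) : Fmap F (gid X) = gid (Fgr F X) := by
  funext i
  simp [Fmap, gid, eqToHom_map]

theorem Fmap_gcomp {X Y Z : GradedObj B} {n m k : ℤ} (h : n + m = k)
    (f : GMap X Y n) (g : GMap Y Z m) :
    Fmap F (gcomp h f g) = gcomp h (Fmap F f) (Fmap F g) := by
  funext i
  simp [Fmap, gcomp, eqToHom_map]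

variable [Preadditive A] [Preadditive B]

theorem KerSq.gcomp_eq_zero {F : B ⥤ A} (hF : KerSq F) {X Y Z : GradedObj B} {n m k : ℤ}
    (h : n + m = k) {f : GMap X Y n} {g : GMap Y Z m} (hf : Fmap F f = 0)
    (hg : Fmap F g = 0) : gcomp h f g = 0 := by
  funext i
  have hfg : f i ≫ g (i + n) = 0 := hF _ _ (congrFun hf i) (congrFun hg (i + n))
  simp only [gcomp, ← Category.assoc, hfg, Limits.zero_comp, Pi.zero_apply]

variable [F.Additive]

theorem Fmap_add {X Y : GradedObj B} {n : ℤ} (f g : GMap X Y n) :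
    Fmap F (f + g) = Fmap F f + Fmap F g := by
  funext i
  simp [Fmap]

theorem Fmap_sub {X Y : GradedObj B} {n : ℤ} (f g : GMap X Y n) :
    Fmap F (f - g) = Fmap F f - Fmap F g := by
  funext i
  simp [Fmap]

theorem Fmap_zsmul {X Y : GradedObj B} {n : ℤ} (c : ℤ) (f : GMap X Y n) :
    Fmap F (c • f) = c • Fmap F f := by
  funext i
  simp [Fmap, F.map_zsmul]

theorem Fmap_gdelta {X Y : GradedObj B} (dX : GMap X X 1) (dY : GMap Y Y 1) {n m : ℤ}
    (h : n + 1 = m) (f : GMap X Y n) :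
    Fmap F (gdelta dX dY h f) = gdelta (Fmap F dX) (Fmap F dY) h (Fmap F f) := by
  simp only [gdelta, Fmap_sub, Fmap_zsmul, Fmap_gcomp]

end Functor

section KilledCocycles

variable {A B : Type*} [Category A] [Preadditive A] [Category B] [Preadditive B]
  {F : B ⥤ A} [F.Additive] {X Y Z : GradedObj B}
  {dX : GMap X X 1} {dY : GMap Y Y 1} {dZ : GMap Z Z 1}
  {p : GMap Y Z 0} {q : GMap Z Y 0} {H : GMap Y Y (-1)}

/-- Postcomposing a killed cocycle with `1 - q ∘ p` gives a killed boundary. -/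
theorem exists_gcomp_gid_sub_eq_gdelta (hF : KerSq F)
    (hH : Fmap F (gdelta dY dY (show (-1 : ℤ) + 1 = 0 by omega) H) =
      Fmap F (gid Y - gcomp (show (0 : ℤ) + 0 = 0 by omega) p q))
    {m : ℤ} (h₀ : m + 0 = m) (h₁ : m - 1 + 1 = m)
    {ξ : GMap X Y m} (hξ : Fmap F ξ = 0) (hδ : gdelta dX dY rfl ξ = 0) :
    ∃ ε : GMap X Y (m - 1), Fmap F ε = 0 ∧
      gcomp h₀ ξ (gid Y - gcomp (show (0 : ℤ) + 0 = 0 by omega) p q)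
        = gdelta dX dY h₁ ε := by
  refine ⟨gcomp (show m + -1 = m - 1 by omega) ξ H, by rw [Fmap_gcomp, hξ, zero_gcomp], ?_⟩
  rw [gdelta_gcomp dX dY dY _ rfl (show (-1 : ℤ) + 1 = 0 by omega), hδ, zero_gcomp, smul_zero,
    add_zero (gcomp _ ξ _), ← sub_eq_zero, ← gcomp_sub]
  exact hF.gcomp_eq_zero _ hξ (by rw [Fmap_sub, hH, sub_self])

/-- Precomposing a killed cocycle with `1 - q ∘ p` gives a killed boundary. -/
theorem exists_gid_sub_gcomp_eq_gdelta (hF : KerSq F)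
    (hH : Fmap F (gdelta dY dY (show (-1 : ℤ) + 1 = 0 by omega) H) =
      Fmap F (gid Y - gcomp (show (0 : ℤ) + 0 = 0 by omega) p q))
    {m : ℤ} (h₀ : 0 + m = m) (h₁ : m - 1 + 1 = m)
    {ξ : GMap Y X m} (hξ : Fmap F ξ = 0) (hδ : gdelta dY dX rfl ξ = 0) :
    ∃ ε : GMap Y X (m - 1), Fmap F ε = 0 ∧
      gcomp h₀ (gid Y - gcomp (show (0 : ℤ) + 0 = 0 by omega) p q) ξ
        = gdelta dY dX h₁ ε := by
  refine ⟨(m.negOnePow : ℤ) • gcomp (show -1 + m = m - 1 by omega) H ξ,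
    by rw [Fmap_zsmul, Fmap_gcomp, hξ, gcomp_zero, smul_zero], ?_⟩
  rw [gdelta_zsmul, gdelta_gcomp dY dY dX _ (show (-1 : ℤ) + 1 = 0 by omega) rfl, hδ,
    gcomp_zero, zero_add (_ • gcomp _ _ ξ), smul_smul, ← Units.val_mul,
    Int.units_mul_self, Units.val_one, one_smul, ← sub_eq_zero, ← sub_gcomp]
  exact hF.gcomp_eq_zero _ (by rw [Fmap_sub, hH, sub_self]) hξ

/-- A killed cocycle whose postcomposition with `p` is a killed boundary is itself one. -/
theorem exists_eq_gdelta_of_gcomp_right (hF : KerSq F)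
    (hH : Fmap F (gdelta dY dY (show (-1 : ℤ) + 1 = 0 by omega) H) =
      Fmap F (gid Y - gcomp (show (0 : ℤ) + 0 = 0 by omega) p q))
    (hq : Fmap F (gdelta dZ dY (show (0 : ℤ) + 1 = 1 by omega) q) = 0)
    {m : ℤ} (h₀ : m + 0 = m) (h₁ : m - 1 + 1 = m)
    {ξ : GMap X Y m} (hξ : Fmap F ξ = 0) (hδ : gdelta dX dY rfl ξ = 0)
    (hp : ∃ ε : GMap X Z (m - 1), Fmap F ε = 0 ∧
      gcomp h₀ ξ p = gdelta dX dZ h₁ ε) :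
    ∃ η : GMap X Y (m - 1), Fmap F η = 0 ∧ ξ = gdelta dX dY h₁ η := by
  obtain ⟨ε, hε, hpε⟩ := hp
  obtain ⟨ε', hε', h⟩ := exists_gcomp_gid_sub_eq_gdelta hF hH h₀ h₁ hξ hδ
  refine ⟨ε' + gcomp (show m - 1 + 0 = m - 1 by omega) ε q,
    by rw [Fmap_add, Fmap_gcomp, hε, hε', zero_gcomp, add_zero], ?_⟩
  rw [gdelta_add, ← h, gdelta_gcomp dX dZ dY _ h₁
    (show (0 : ℤ) + 1 = 1 by omega), hF.gcomp_eq_zero _ hε hq, ← hpε, gcomp_sub, gcomp_gid,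
    gcomp_assoc h₀ _ (show (0 : ℤ) + 0 = 0 by omega) h₀]
  simp

/-- A killed cocycle whose precomposition with `q` is a killed boundary is itself one. -/
theorem exists_eq_gdelta_of_gcomp_left (hF : KerSq F)
    (hH : Fmap F (gdelta dY dY (show (-1 : ℤ) + 1 = 0 by omega) H) =
      Fmap F (gid Y - gcomp (show (0 : ℤ) + 0 = 0 by omega) p q))
    (hp : Fmap F (gdelta dY dZ (show (0 : ℤ) + 1 = 1 by omega) p) = 0)
    {m : ℤ} (h₀ : 0 + m = m) (h₁ : m - 1 + 1 = m)
    {ξ : GMap Y X m} (hξ : Fmap F ξ = 0) (hδ : gdelta dY dX rfl ξ = 0)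
    (hq : ∃ ε : GMap Z X (m - 1), Fmap F ε = 0 ∧
      gcomp h₀ q ξ = gdelta dZ dX h₁ ε) :
    ∃ η : GMap Y X (m - 1), Fmap F η = 0 ∧ ξ = gdelta dY dX h₁ η := by
  obtain ⟨ε, hε, hqε⟩ := hq
  obtain ⟨ε', hε', h⟩ := exists_gid_sub_gcomp_eq_gdelta hF hH h₀ h₁ hξ hδ
  refine ⟨ε' + gcomp (show 0 + (m - 1) = m - 1 by omega) p ε,
    by rw [Fmap_add, Fmap_gcomp, hε, hε', gcomp_zero, add_zero], ?_⟩
  rw [gdelta_add, ← h, gdelta_gcomp dY dZ dX _ (show (0 : ℤ) + 1 = 1 by omega)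
    h₁, hF.gcomp_eq_zero _ hp hε, ← hqε, sub_gcomp, gid_gcomp,
    gcomp_assoc (show (0 : ℤ) + 0 = 0 by omega) _ h₀ h₀]
  simp

end KilledCocycles

/-- Lemma `techlem`: with lifted data `d̄_C, d̄_D, f̄, ḡ, H̄, K̄` of the
homotopy-equivalence data `d_C, d_D, f, g, H, K`, for every `F`-killed `δ̄`-cocycle `ξ`
with source and target among `C̄`, `D̄`: (1) composing `ξ` with `1 − ḡ∘f̄` or `1 − f̄∘ḡ`
(on either side, whenever the composition makes sense) gives a `δ̄`-boundary of an
`F`-killed map; and (2) if one of `f̄∘ξ`, `ξ∘f̄`, `ḡ∘ξ`, `ξ∘ḡ` is a `δ̄`-boundary of an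
`F`-killed map then so is `ξ` itself. -/
theorem statement10 {B C : Type*} [Category B] [Preadditive B] [Category C] [Preadditive C]
    (F : B ⥤ C) [F.Additive] [F.Full] (hF : KerSq F)
    (Xb Yb : GradedObj B)
    (dC : GMap (Fgr F Xb) (Fgr F Xb) 1) (dD : GMap (Fgr F Yb) (Fgr F Yb) 1)
    (hdC : gcomp (show (1:ℤ) + 1 = 2 by omega) dC dC = 0)
    (hdD : gcomp (show (1:ℤ) + 1 = 2 by omega) dD dD = 0)
    (f : GMap (Fgr F Xb) (Fgr F Yb) 0) (g : GMap (Fgr F Yb) (Fgr F Xb) 0)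
    (hf : gdelta dC dD (show (0:ℤ) + 1 = 1 by omega) f = 0)
    (hg : gdelta dD dC (show (0:ℤ) + 1 = 1 by omega) g = 0)
    (H : GMap (Fgr F Xb) (Fgr F Xb) (-1))
    (hH : gdelta dC dC (show (-1:ℤ) + 1 = 0 by omega) H
      = gid (Fgr F Xb) - gcomp (show (0:ℤ) + 0 = 0 by omega) f g)
    (K : GMap (Fgr F Yb) (Fgr F Yb) (-1))
    (hK : gdelta dD dD (show (-1:ℤ) + 1 = 0 by omega) K
      = gid (Fgr F Yb) - gcomp (show (0:ℤ) + 0 = 0 by omega) g f)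
    (dCb : GMap Xb Xb 1) (hdCb : Fmap F dCb = dC)
    (dDb : GMap Yb Yb 1) (hdDb : Fmap F dDb = dD)
    (fb : GMap Xb Yb 0) (hfb : Fmap F fb = f)
    (gb : GMap Yb Xb 0) (hgb : Fmap F gb = g)
    (Hb : GMap Xb Xb (-1)) (hHb : Fmap F Hb = H)
    (Kb : GMap Yb Yb (-1)) (hKb : Fmap F Kb = K) :
    -- ξ : C̄ → C̄
    (∀ (m : ℤ) (ξ : GMap Xb Xb m), Fmap F ξ = 0 → gdelta dCb dCb rfl ξ = 0 →
      ((∃ ε : GMap Xb Xb (m - 1), Fmap F ε = 0 ∧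
          gcomp (show m + 0 = m by omega) ξ
              (gid Xb - gcomp (show (0:ℤ) + 0 = 0 by omega) fb gb)
            = gdelta dCb dCb (show m - 1 + 1 = m by omega) ε) ∧
       (∃ ε : GMap Xb Xb (m - 1), Fmap F ε = 0 ∧
          gcomp (show 0 + m = m by omega)
              (gid Xb - gcomp (show (0:ℤ) + 0 = 0 by omega) fb gb) ξ
            = gdelta dCb dCb (show m - 1 + 1 = m by omega) ε) ∧
       ((∃ ε : GMap Xb Yb (m - 1), Fmap F ε = 0 ∧
           gcomp (show m + 0 = m by omega) ξ fb
             = gdelta dCb dDb (show m - 1 + 1 = m by omega) ε) →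
         ∃ η : GMap Xb Xb (m - 1), Fmap F η = 0 ∧
           ξ = gdelta dCb dCb (show m - 1 + 1 = m by omega) η) ∧
       ((∃ ε : GMap Yb Xb (m - 1), Fmap F ε = 0 ∧
           gcomp (show 0 + m = m by omega) gb ξ
             = gdelta dDb dCb (show m - 1 + 1 = m by omega) ε) →
         ∃ η : GMap Xb Xb (m - 1), Fmap F η = 0 ∧
           ξ = gdelta dCb dCb (show m - 1 + 1 = m by omega) η))) ∧
    -- ξ : C̄ → D̄
    (∀ (m : ℤ) (ξ : GMap Xb Yb m), Fmap F ξ = 0 → gdelta dCb dDb rfl ξ = 0 →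
      ((∃ ε : GMap Xb Yb (m - 1), Fmap F ε = 0 ∧
          gcomp (show m + 0 = m by omega) ξ
              (gid Yb - gcomp (show (0:ℤ) + 0 = 0 by omega) gb fb)
            = gdelta dCb dDb (show m - 1 + 1 = m by omega) ε) ∧
       (∃ ε : GMap Xb Yb (m - 1), Fmap F ε = 0 ∧
          gcomp (show 0 + m = m by omega)
              (gid Xb - gcomp (show (0:ℤ) + 0 = 0 by omega) fb gb) ξ
            = gdelta dCb dDb (show m - 1 + 1 = m by omega) ε) ∧
       ((∃ ε : GMap Xb Xb (m - 1), Fmap F ε = 0 ∧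
           gcomp (show m + 0 = m by omega) ξ gb
             = gdelta dCb dCb (show m - 1 + 1 = m by omega) ε) →
         ∃ η : GMap Xb Yb (m - 1), Fmap F η = 0 ∧
           ξ = gdelta dCb dDb (show m - 1 + 1 = m by omega) η) ∧
       ((∃ ε : GMap Yb Yb (m - 1), Fmap F ε = 0 ∧
           gcomp (show 0 + m = m by omega) gb ξ
             = gdelta dDb dDb (show m - 1 + 1 = m by omega) ε) →
         ∃ η : GMap Xb Yb (m - 1), Fmap F η = 0 ∧
           ξ = gdelta dCb dDb (show m - 1 + 1 = m by omega) η))) ∧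
    -- ξ : D̄ → C̄
    (∀ (m : ℤ) (ξ : GMap Yb Xb m), Fmap F ξ = 0 → gdelta dDb dCb rfl ξ = 0 →
      ((∃ ε : GMap Yb Xb (m - 1), Fmap F ε = 0 ∧
          gcomp (show m + 0 = m by omega) ξ
              (gid Xb - gcomp (show (0:ℤ) + 0 = 0 by omega) fb gb)
            = gdelta dDb dCb (show m - 1 + 1 = m by omega) ε) ∧
       (∃ ε : GMap Yb Xb (m - 1), Fmap F ε = 0 ∧
          gcomp (show 0 + m = m by omega)
              (gid Yb - gcomp (show (0:ℤ) + 0 = 0 by omega) gb fb) ξ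
            = gdelta dDb dCb (show m - 1 + 1 = m by omega) ε) ∧
       ((∃ ε : GMap Yb Yb (m - 1), Fmap F ε = 0 ∧
           gcomp (show m + 0 = m by omega) ξ fb
             = gdelta dDb dDb (show m - 1 + 1 = m by omega) ε) →
         ∃ η : GMap Yb Xb (m - 1), Fmap F η = 0 ∧
           ξ = gdelta dDb dCb (show m - 1 + 1 = m by omega) η) ∧
       ((∃ ε : GMap Xb Xb (m - 1), Fmap F ε = 0 ∧
           gcomp (show 0 + m = m by omega) fb ξ
             = gdelta dCb dCb (show m - 1 + 1 = m by omega) ε) →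
         ∃ η : GMap Yb Xb (m - 1), Fmap F η = 0 ∧
           ξ = gdelta dDb dCb (show m - 1 + 1 = m by omega) η))) ∧
    -- ξ : D̄ → D̄
    (∀ (m : ℤ) (ξ : GMap Yb Yb m), Fmap F ξ = 0 → gdelta dDb dDb rfl ξ = 0 →
      ((∃ ε : GMap Yb Yb (m - 1), Fmap F ε = 0 ∧
          gcomp (show m + 0 = m by omega) ξ
              (gid Yb - gcomp (show (0:ℤ) + 0 = 0 by omega) gb fb)
            = gdelta dDb dDb (show m - 1 + 1 = m by omega) ε) ∧
       (∃ ε : GMap Yb Yb (m - 1), Fmap F ε = 0 ∧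
          gcomp (show 0 + m = m by omega)
              (gid Yb - gcomp (show (0:ℤ) + 0 = 0 by omega) gb fb) ξ
            = gdelta dDb dDb (show m - 1 + 1 = m by omega) ε) ∧
       ((∃ ε : GMap Yb Xb (m - 1), Fmap F ε = 0 ∧
           gcomp (show m + 0 = m by omega) ξ gb
             = gdelta dDb dCb (show m - 1 + 1 = m by omega) ε) →
         ∃ η : GMap Yb Yb (m - 1), Fmap F η = 0 ∧
           ξ = gdelta dDb dDb (show m - 1 + 1 = m by omega) η) ∧
       ((∃ ε : GMap Xb Yb (m - 1), Fmap F ε = 0 ∧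
           gcomp (show 0 + m = m by omega) fb ξ
             = gdelta dCb dDb (show m - 1 + 1 = m by omega) ε) →
         ∃ η : GMap Yb Yb (m - 1), Fmap F η = 0 ∧
           ξ = gdelta dDb dDb (show m - 1 + 1 = m by omega) η))) := by
  subst hdCb hdDb hfb hgb hHb hKb
  rw [← Fmap_gdelta] at hf hg
  rw [← Fmap_gdelta, ← Fmap_gid, ← Fmap_gcomp, ← Fmap_sub] at hH hK
  exact
    ⟨fun _ _ hξ hδ => ⟨exists_gcomp_gid_sub_eq_gdelta hF hH _ _ hξ hδ,
      exists_gid_sub_gcomp_eq_gdelta hF hH _ _ hξ hδ,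
      exists_eq_gdelta_of_gcomp_right hF hH hg _ _ hξ hδ,
      exists_eq_gdelta_of_gcomp_left hF hH hf _ _ hξ hδ⟩,
    fun _ _ hξ hδ => ⟨exists_gcomp_gid_sub_eq_gdelta hF hK _ _ hξ hδ,
      exists_gid_sub_gcomp_eq_gdelta hF hH _ _ hξ hδ,
      exists_eq_gdelta_of_gcomp_right hF hK hf _ _ hξ hδ,
      exists_eq_gdelta_of_gcomp_left hF hH hf _ _ hξ hδ⟩,
    fun _ _ hξ hδ => ⟨exists_gcomp_gid_sub_eq_gdelta hF hH _ _ hξ hδ,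
      exists_gid_sub_gcomp_eq_gdelta hF hK _ _ hξ hδ,
      exists_eq_gdelta_of_gcomp_right hF hH hg _ _ hξ hδ,
      exists_eq_gdelta_of_gcomp_left hF hK hg _ _ hξ hδ⟩,
    fun _ _ hξ hδ => ⟨exists_gcomp_gid_sub_eq_gdelta hF hK _ _ hξ hδ,
      exists_gid_sub_gcomp_eq_gdelta hF hK _ _ hξ hδ,
      exists_eq_gdelta_of_gcomp_right hF hK hf _ _ hξ hδ,
      exists_eq_gdelta_of_gcomp_left hF hK hg _ _ hξ hδ⟩⟩

end Paper
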